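/- There exists a universal constant c₀ > 0 with the following property. Let p ∈ (0,1] and let r > 0 satisfy 1 − (√(4/(4−π)) + 0.01)·2^{1/p−1}·(2/r)^{1/p−1/2} > 0. Then there exists a constant C > 0 depending only on r such that for all positive integers k ≤ n and all m ≥ C·k·log(en/k): if A ∈ ℂ^{m×n} is a standard complex Gaussian random matrix, then with probability at least 1 − exp(−c₀·m) there exist constants L, U > 0 with √(4/(4−π)) ≤ U/L ≤ √(4/(4−π)) + 0.01 such that A satisfies the phaseless bi-Lipschitz condition with constants L, U on the set {z ∈ ℂ^n : ‖z‖₀ ≤ (r+4)k}. -/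

import Mathlib

open MeasureTheory ProbabilityTheory Real Finset

/-- The `ℓ_q` (quasi-)norm `(∑ i, ‖x i‖^q)^{1/q}` of a vector with entries in `𝕜 ∈ {ℝ, ℂ}`. -/
noncomputable def lpNorm {ι : Type*} [Fintype ι] {𝕜 : Type*} [RCLike 𝕜] (q : ℝ) (x : ι → 𝕜) : ℝ :=
  (∑ i, ‖x i‖ ^ q) ^ (1 / q)

open Classical in
/-- The number of nonzero entries of a vector. -/
noncomputable def l0Norm {ι : Type*} [Fintype ι] {𝕜 : Type*} [RCLike 𝕜] (x : ι → 𝕜) : ℕ :=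
  (Finset.univ.filter fun i => x i ≠ 0).card

/-- The phase distance `dist_q(x,y) = inf_{|c|=1} ‖x - c • y‖_q`. -/
noncomputable def phaseDist {ι : Type*} [Fintype ι] {𝕜 : Type*} [RCLike 𝕜] (q : ℝ)
    (x y : ι → 𝕜) : ℝ :=
  sInf {d | ∃ c : 𝕜, ‖c‖ = 1 ∧ d = lpNorm q (fun i => x i - c * y i)}

/-- The best `k`-term approximation error `σ_k(x)_q = inf {‖x - z‖_q : ‖z‖₀ ≤ k}`. -/
noncomputable def sigmaK {ι : Type*} [Fintype ι] {𝕜 : Type*} [RCLike 𝕜] (k : ℕ) (q : ℝ)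
    (x : ι → 𝕜) : ℝ :=
  sInf {d | ∃ z : ι → 𝕜, l0Norm z ≤ k ∧ d = lpNorm q (fun i => x i - z i)}

/-- The entrywise modulus `|Ax|` of the matrix-vector product `Ax`. -/
noncomputable def absMv {m n : ℕ} {𝕜 : Type*} [RCLike 𝕜] (A : Fin m → Fin n → 𝕜)
    (x : Fin n → 𝕜) : Fin m → ℝ :=
  fun i => ‖∑ j, A i j * x j‖

/-- `A` satisfies the phaseless bi-Lipschitz condition on `X` with constants `L, U`:
`L·dist(x,y) ≤ ‖|Ax| - |Ay|‖₂ ≤ U·dist(x,y)` for all `x, y ∈ X`. -/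
def PhaselessBiLip {m n : ℕ} {𝕜 : Type*} [RCLike 𝕜] (A : Fin m → Fin n → 𝕜)
    (X : Set (Fin n → 𝕜)) (L U : ℝ) : Prop :=
  ∀ x ∈ X, ∀ y ∈ X,
    L * phaseDist 2 x y ≤ lpNorm 2 (fun i => absMv A x i - absMv A y i) ∧
    lpNorm 2 (fun i => absMv A x i - absMv A y i) ≤ U * phaseDist 2 x y

/-- The law of a standard complex Gaussian random matrix `A ∈ ℂ^{m×n}`: the pushforward, under
the entrywise map `(x,y) ↦ x + i·y`, of the product over the `m·n` entries of the product of two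
real Gaussian measures with mean `0` and variance `1/2`. -/
noncomputable def gaussMatrixComplex (m n : ℕ) : Measure (Fin m → Fin n → ℂ) :=
  Measure.map (fun g : Fin m → Fin n → ℝ × ℝ => fun i j => ((g i j).1 : ℂ) + (g i j).2 * Complex.I)
    (Measure.pi fun _ : Fin m => Measure.pi fun _ : Fin n =>
      (gaussianReal 0 (1/2)).prod (gaussianReal 0 (1/2)))

/-- The standard complex Gaussian measure on `ℂ`. -/
noncomputable def gaussComplex : Measure ℂ :=
  ((gaussianReal 0 (1/2)).prod (gaussianReal 0 (1/2))).map
    (fun p : ℝ × ℝ => (p.1 : ℂ) + p.2 * Complex.I)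

lemma gaussComplex_map_measurable :
    Measurable (fun p : ℝ × ℝ => (p.1 : ℂ) + p.2 * Complex.I) := by fun_prop

instance : IsProbabilityMeasure gaussComplex :=
  Measure.isProbabilityMeasure_map gaussComplex_map_measurable.aemeasurable

lemma gaussMatrixComplex_eq_pi (m n : ℕ) :
    gaussMatrixComplex m n =
      Measure.pi fun _ : Fin m => Measure.pi fun _ : Fin n => gaussComplex := by
  have h1 : ∀ _ : Fin m, AEMeasurable
      (fun (g : Fin n → ℝ × ℝ) (j : Fin n) => ((g j).1 : ℂ) + (g j).2 * Complex.I)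
      (Measure.pi fun _ : Fin n => (gaussianReal 0 (1/2)).prod (gaussianReal 0 (1/2))) :=
    fun _ => by fun_prop
  have h2 : Measure.map
      (fun (g : Fin n → ℝ × ℝ) (j : Fin n) => ((g j).1 : ℂ) + (g j).2 * Complex.I)
      (Measure.pi fun _ : Fin n => (gaussianReal 0 (1/2)).prod (gaussianReal 0 (1/2)))
      = Measure.pi fun _ : Fin n => gaussComplex :=
    Measure.pi_map_pi (fun _ => gaussComplex_map_measurable.aemeasurable)
  have : SigmaFinite (Measure.map
      (fun (g : Fin n → ℝ × ℝ) (j : Fin n) => ((g j).1 : ℂ) + (g j).2 * Complex.I)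
      (Measure.pi fun _ : Fin n => (gaussianReal 0 (1/2)).prod (gaussianReal 0 (1/2)))) := by
    rw [h2]; infer_instance
  unfold gaussMatrixComplex
  have h3 := Measure.pi_map_pi (ι := Fin m) h1
  rw [h3]
  simp_rw [h2]

lemma charFunDual_gaussComplex (L : StrongDual ℝ ℂ) :
    charFunDual gaussComplex L
      = Complex.exp (-((L 1 ^ 2 + L Complex.I ^ 2 : ℝ) : ℂ) / 4) := by
  let e : ℝ × ℝ →L[ℝ] ℂ := LinearMap.toContinuousLinearMap
    { toFun := fun p => (p.1 : ℂ) + p.2 * Complex.I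
      map_add' := fun a b => by simp; ring
      map_smul' := fun c a => by simp; ring }
  have h : charFunDual gaussComplex L = _ :=
    charFunDual_map (μ := (gaussianReal 0 (1/2)).prod (gaussianReal 0 (1/2))) e L
  have hreal : ∀ M : StrongDual ℝ ℝ, charFunDual (gaussianReal 0 (1/2)) M
      = Complex.exp (-((M 1 ^ 2 : ℝ) : ℂ) / 4) := by
    intro M
    have hM : ∀ v, M v = v * M 1 := fun v => by
      conv_lhs => rw [← mul_one v, ← smul_eq_mul, map_smul, smul_eq_mul]
    have := charFun_gaussianReal (μ := 0) (v := 1/2) (M 1)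
    rw [charFun_apply_real] at this
    rw [charFunDual_apply]
    calc _ = ∫ x : ℝ, Complex.exp (M 1 * x * Complex.I) ∂(gaussianReal 0 (1/2)) := by
          congr 1; ext x; rw [hM x]; push_cast; ring_nf
      _ = _ := by
          rw [this]; congr 1; push_cast; ring
  rw [h, charFunDual_prod, hreal, hreal, ← Complex.exp_add]
  congr 1
  simp [e]
  ring

/-- Under the row law, the pairings with two orthogonal vectors are independent. -/
lemma map_pairing_of_orthogonal {n : ℕ} (x y : Fin n → ℂ)
    (hxy : ∑ j, x j * (starRingEnd ℂ) (y j) = 0) (p q : ℝ)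
    (hp : p ^ 2 = ∑ j, ‖x j‖ ^ 2) (hq : q ^ 2 = ∑ j, ‖y j‖ ^ 2) :
    (Measure.pi fun _ : Fin n => gaussComplex).map
        (fun a => (∑ j, a j * x j, ∑ j, a j * y j)) =
      (gaussComplex.prod gaussComplex).map (fun z => ((p : ℂ) * z.1, (q : ℂ) * z.2)) := by
  classical
  let Φ : (Fin n → ℂ) →L[ℝ] ℂ × ℂ := LinearMap.toContinuousLinearMap
    { toFun := fun a => (∑ j, a j * x j, ∑ j, a j * y j)
      map_add' := fun a b => by simp [add_mul, Finset.sum_add_distrib]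
      map_smul' := fun c a => by simp [Finset.mul_sum, mul_assoc] }
  let Ψ : ℂ × ℂ →L[ℝ] ℂ × ℂ := LinearMap.toContinuousLinearMap
    { toFun := fun z => ((p : ℂ) * z.1, (q : ℂ) * z.2)
      map_add' := fun a b => by simp [mul_add]
      map_smul' := fun c a => by simp [mul_left_comm] }
  change (Measure.pi fun _ : Fin n => gaussComplex).map Φ =
      (gaussComplex.prod gaussComplex).map Ψ
  have : IsFiniteMeasure ((Measure.pi fun _ : Fin n => gaussComplex).map Φ) :=
    Measure.isFiniteMeasure_map _ _
  apply Measure.ext_of_charFunDual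
  ext L
  rw [charFunDual_map, charFunDual_map, charFunDual_pi, charFunDual_prod]
  simp_rw [charFunDual_gaussComplex]
  rw [← Complex.exp_sum, ← Complex.exp_add]
  have hL : ∀ u v : ℂ, L (u, v) = u.re * L (1, 0) + u.im * L (Complex.I, 0)
      + v.re * L (0, 1) + v.im * L (0, Complex.I) := by
    intro u v
    have : ((u, v) : ℂ × ℂ) = u.re • ((1 : ℂ), (0 : ℂ)) + u.im • (Complex.I, (0 : ℂ))
        + v.re • ((0 : ℂ), (1 : ℂ)) + v.im • ((0 : ℂ), Complex.I) := by
      ext <;> simp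
    rw [this]
    simp only [map_add, map_smul, smul_eq_mul]
  have hΦ : ∀ (j : Fin n) (c : ℂ),
      (L.comp Φ).comp (ContinuousLinearMap.single ℝ (fun _ => ℂ) j) c
        = L (c * x j, c * y j) := by
    intro j c
    simp [Φ, Pi.single_apply, ite_mul]
  have hΨ1 : ∀ c : ℂ, (L.comp Ψ).comp (ContinuousLinearMap.inl ℝ ℂ ℂ) c = L (p * c, 0) := by
    intro c; simp [Ψ]
  have hΨ2 : ∀ c : ℂ, (L.comp Ψ).comp (ContinuousLinearMap.inr ℝ ℂ ℂ) c = L (0, q * c) := by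
    intro c; simp [Ψ]
  simp only [hΦ, hΨ1, hΨ2]
  congr 1
  rw [← Finset.sum_div, Finset.sum_neg_distrib, ← Complex.ofReal_sum, ← add_div, ← neg_add,
    ← Complex.ofReal_add]
  congr 3
  set a := L (1, 0)
  set a' := L (Complex.I, 0)
  set b := L (0, 1)
  set b' := L (0, Complex.I)
  have hre : ∑ j, ((x j).re * (y j).re + (x j).im * (y j).im) = 0 := by
    have := congrArg Complex.re hxy
    simpa [Complex.re_sum] using this
  have him : ∑ j, ((x j).im * (y j).re - (x j).re * (y j).im) = 0 := by
    have := congrArg Complex.im hxy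
    rw [Complex.im_sum, Complex.zero_im] at this
    rw [← this]
    exact Finset.sum_congr rfl fun j _ => by simp; ring
  have hexp : ∀ j, L (1 * x j, 1 * y j) ^ 2 + L (Complex.I * x j, Complex.I * y j) ^ 2
      = ‖x j‖ ^ 2 * (a ^ 2 + a' ^ 2) + ‖y j‖ ^ 2 * (b ^ 2 + b' ^ 2)
        + ((x j).re * (y j).re + (x j).im * (y j).im) * (2 * (a * b + a' * b'))
        + ((x j).im * (y j).re - (x j).re * (y j).im) * (2 * (a' * b - a * b')) := by
    intro j
    rw [hL, hL (Complex.I * x j), Complex.sq_norm, Complex.sq_norm, Complex.normSq_apply,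
      Complex.normSq_apply]
    simp
    ring
  rw [Finset.sum_congr rfl fun j _ => hexp j]
  rw [Finset.sum_add_distrib, Finset.sum_add_distrib, Finset.sum_add_distrib]
  simp only [← Finset.sum_mul]
  rw [hre, him, ← hp, ← hq, hL, hL _ 0, hL 0, hL 0]
  simp
  ring

lemma integral_gaussComplex (f : ℂ → ℝ) :
    ∫ z, f z ∂gaussComplex = π⁻¹ * ∫ z : ℂ, Real.exp (-‖z‖ ^ 2) * f z := by
  have hpdf : ∀ p : ℝ × ℝ, gaussianPDFReal 0 (1/2) p.1 * gaussianPDFReal 0 (1/2) p.2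
      = π⁻¹ * Real.exp (-‖Complex.measurableEquivRealProd.symm p‖ ^ 2) := by
    intro p
    have h1 : ‖Complex.measurableEquivRealProd.symm p‖ ^ 2 = p.1 ^ 2 + p.2 ^ 2 := by
      rw [Complex.sq_norm, Complex.normSq_apply]; simp [pow_two]
    have h2 : ((1/2 : NNReal) : ℝ) = 1/2 := by push_cast; rfl
    have h3 : Real.sqrt (2 * π * (1 / 2)) = Real.sqrt π := by congr 1; ring
    rw [h1, gaussianPDFReal, gaussianPDFReal, h2, h3, mul_mul_mul_comm, ← Real.exp_add,
      ← mul_inv, Real.mul_self_sqrt Real.pi_pos.le]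
    congr 2
    ring
  have hm : (gaussianReal 0 (1/2)).prod (gaussianReal 0 (1/2)) =
      (volume : Measure (ℝ × ℝ)).withDensity
        (fun p => gaussianPDF 0 (1/2) p.1 * gaussianPDF 0 (1/2) p.2) := by
    rw [gaussianReal_of_var_ne_zero _ (by norm_num), prod_withDensity (by fun_prop) (by fun_prop)]
    rfl
  have he : (fun p : ℝ × ℝ => (p.1 : ℂ) + p.2 * Complex.I)
      = Complex.measurableEquivRealProd.symm := by
    ext p
    exact (Complex.mk_eq_add_mul_I p.1 p.2).symm
  rw [gaussComplex, he, MeasureTheory.integral_map_equiv, hm,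
    integral_withDensity_eq_integral_toReal_smul (by fun_prop)
      (ae_of_all _ fun p => ENNReal.mul_lt_top gaussianPDF_lt_top gaussianPDF_lt_top),
    ← integral_const_mul,
    ← Complex.volume_preserving_equiv_real_prod.symm.integral_comp
      Complex.measurableEquivRealProd.symm.measurableEmbedding]
  congr 1
  ext p
  rw [ENNReal.toReal_mul, toReal_gaussianPDF, toReal_gaussianPDF, hpdf, smul_eq_mul, mul_assoc]

lemma integral_norm_rpow_gaussComplex {q : ℝ} (hq : -2 < q) :
    ∫ z, ‖z‖ ^ q ∂gaussComplex = Real.Gamma ((q + 2) / 2) := by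
  rw [integral_gaussComplex]
  have := Complex.integral_rpow_mul_exp_neg_rpow (p := 2) (q := q) (by norm_num) hq
  simp only [Real.rpow_two] at this
  simp_rw [mul_comm (Real.exp _)]
  rw [this]
  field_simp [Real.pi_pos.ne']

lemma integrable_norm_rpow_gaussComplex {q : ℝ} (hq : -2 < q) :
    Integrable (fun z : ℂ => ‖z‖ ^ q) gaussComplex :=
  .of_integral_ne_zero <| by
    rw [integral_norm_rpow_gaussComplex hq]
    exact (Real.Gamma_pos_of_pos (by linarith)).ne'

lemma integral_exp_mul_norm_sq_gaussComplex {l : ℝ} (hl : l < 1) :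
    ∫ z, Real.exp (l * ‖z‖ ^ 2) ∂gaussComplex = (1 - l)⁻¹ := by
  rw [integral_gaussComplex]
  have := Complex.integral_exp_neg_mul_rpow (p := 2) (b := 1 - l) (by norm_num) (by linarith)
  simp only [Real.rpow_two] at this
  simp_rw [← Real.exp_add]
  have h2 : ∀ z : ℂ, -‖z‖ ^ 2 + l * ‖z‖ ^ 2 = -(1 - l) * ‖z‖ ^ 2 := fun z => by ring
  simp_rw [h2, this]
  have h3 : Real.Gamma (2 / 2 + 1) = 1 := by norm_num
  have h4 : (1 - l) ^ (-2 / 2 : ℝ) = (1 - l)⁻¹ := by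
    norm_num [Real.rpow_neg_one]
  rw [h3, h4]
  field_simp [Real.pi_pos.ne']

lemma integral_norm_gaussComplex : ∫ z, ‖z‖ ∂gaussComplex = Real.sqrt π / 2 := by
  have := integral_norm_rpow_gaussComplex (q := 1) (by norm_num)
  simp only [Real.rpow_one] at this
  rw [this, show ((1 : ℝ) + 2) / 2 = 1 / 2 + 1 by norm_num, Real.Gamma_add_one (by norm_num),
    Real.Gamma_one_half_eq]
  ring

lemma integrable_norm_gaussComplex : Integrable (fun z : ℂ => ‖z‖) gaussComplex := by
  simpa using integrable_norm_rpow_gaussComplex (q := 1) (by norm_num)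

lemma integral_norm_sq_gaussComplex : ∫ z, ‖z‖ ^ 2 ∂gaussComplex = 1 := by
  have := integral_norm_rpow_gaussComplex (q := 2) (by norm_num)
  simp only [Real.rpow_two] at this
  rw [this, show ((2 : ℝ) + 2) / 2 = 2 by norm_num, Real.Gamma_two]

lemma integrable_norm_sq_gaussComplex : Integrable (fun z : ℂ => ‖z‖ ^ 2) gaussComplex := by
  simpa using integrable_norm_rpow_gaussComplex (q := 2) (by norm_num)

lemma integral_norm_pow_four_gaussComplex : ∫ z, ‖z‖ ^ 4 ∂gaussComplex = 2 := by
  have := integral_norm_rpow_gaussComplex (q := (4 : ℕ)) (by norm_num)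
  simp only [Real.rpow_natCast] at this
  rw [this, show (((4 : ℕ) : ℝ) + 2) / 2 = 2 + 1 by norm_num, Real.Gamma_add_one (by norm_num),
    Real.Gamma_two]
  norm_num

lemma integrable_norm_pow_four_gaussComplex :
    Integrable (fun z : ℂ => ‖z‖ ^ 4) gaussComplex := by
  simpa only [Real.rpow_natCast] using
    integrable_norm_rpow_gaussComplex (q := (4 : ℕ)) (by norm_num)

/-- Chernoff bound for sums of independent copies. -/
lemma measure_pi_sum_ge_le {α : Type*} [MeasurableSpace α] {ν : Measure α}
    [IsProbabilityMeasure ν] {X : α → ℝ}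
    (h_int : Integrable (fun a => Real.exp (X a)) ν) {b : ℝ}
    (hb : ∫ a, Real.exp (X a) ∂ν ≤ Real.exp b) (m : ℕ) (t : ℝ) :
    (Measure.pi fun _ : Fin m => ν) {A | t ≤ ∑ i, X (A i)}
      ≤ ENNReal.ofReal (Real.exp (m * b - t)) := by
  have hI : Integrable (fun A : Fin m → α => ∏ i, Real.exp (X (A i)))
      (Measure.pi fun _ : Fin m => ν) :=
    Integrable.fintype_prod (f := fun _ a => Real.exp (X a)) fun _ => h_int
  have hE : ∫ A : Fin m → α, ∏ i, Real.exp (X (A i)) ∂(Measure.pi fun _ : Fin m => ν)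
      ≤ Real.exp (m * b) := by
    rw [integral_fintype_prod_eq_pow (ι := Fin m) (fun a => Real.exp (X a)), Fintype.card_fin,
      Real.exp_nat_mul]
    exact pow_le_pow_left₀ (integral_nonneg fun _ => (Real.exp_pos _).le) hb m
  have hM := mul_meas_ge_le_integral_of_nonneg (μ := Measure.pi fun _ : Fin m => ν)
    (ae_of_all _ fun A => Finset.prod_nonneg fun i _ => (Real.exp_pos (X (A i))).le) hI
    (Real.exp t)
  have hset : {A : Fin m → α | Real.exp t ≤ ∏ i, Real.exp (X (A i))}
      = {A | t ≤ ∑ i, X (A i)} := by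
    ext A
    rw [Set.mem_ofPred_eq, Set.mem_ofPred_eq, ← Real.exp_sum, Real.exp_le_exp]
  rw [hset] at hM
  have h3 : (Measure.pi fun _ : Fin m => ν).real {A | t ≤ ∑ i, X (A i)}
      ≤ Real.exp (m * b - t) := by
    rw [Real.exp_sub, le_div_iff₀ (Real.exp_pos t), mul_comm]
    exact hM.trans hE
  rw [← ENNReal.ofReal_toReal (measure_ne_top _ _)]
  exact ENNReal.ofReal_le_ofReal h3

lemma inv_one_sub_le_exp {l : ℝ} (h0 : 0 ≤ l) (h1 : l ≤ 1 / 2) :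
    (1 - l)⁻¹ ≤ Real.exp (l + l ^ 2) := by
  have h2 : l + l ^ 2 + 1 + (l + l ^ 2) ^ 2 / 2 ≤ Real.exp (l + l ^ 2) := by
    have := Real.quadratic_le_exp_of_nonneg (x := l + l ^ 2) (by positivity)
    linarith
  refine le_trans ?_ h2
  rw [inv_le_iff_one_le_mul₀ (by linarith)]
  nlinarith [mul_nonneg h0 h0, pow_nonneg h0 3, pow_nonneg h0 4,
    mul_nonneg (pow_nonneg h0 2) (sub_nonneg.2 h1), mul_nonneg (pow_nonneg h0 3) (sub_nonneg.2 h1),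
    mul_nonneg (pow_nonneg h0 4) (sub_nonneg.2 h1)]

lemma map_pairing_of_unit {n : ℕ} (x : Fin n → ℂ) (hx : ∑ j, ‖x j‖ ^ 2 = 1) :
    (Measure.pi fun _ : Fin n => gaussComplex).map (fun a => ∑ j, a j * x j) = gaussComplex := by
  have h := map_pairing_of_orthogonal x 0 (by simp) 1 0 (by simp [hx]) (by simp)
  have h2 := congrArg (Measure.map Prod.fst) h
  rw [Measure.map_map measurable_fst (by fun_prop), Measure.map_map measurable_fst (by fun_prop)]
    at h2
  have e : (Prod.fst ∘ fun z : ℂ × ℂ => (((1 : ℝ) : ℂ) * z.1, ((0 : ℝ) : ℂ) * z.2)) = Prod.fst := by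
    ext z; simp
  rw [e, Measure.map_fst_prod, measure_univ, one_smul] at h2
  exact h2

/-- Upper tail of `‖Ax‖²` for a unit vector `x`. -/
lemma upper_tail {n : ℕ} (m : ℕ) (x : Fin n → ℂ) (hx : ∑ j, ‖x j‖ ^ 2 = 1) :
    gaussMatrixComplex m n {A | 1.001 * m ≤ ∑ i, ‖∑ j, A i j * x j‖ ^ 2}
      ≤ ENNReal.ofReal (Real.exp (-(0.0000000005) * m)) := by
  have hmeas : Measurable (fun a : Fin n → ℂ => ∑ j, a j * x j) := by fun_prop
  have hE : ∫ a : Fin n → ℂ, Real.exp (1/2000 * ‖∑ j, a j * x j‖ ^ 2)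
      ∂(Measure.pi fun _ : Fin n => gaussComplex) = (1 - 1/2000 : ℝ)⁻¹ := by
    rw [← integral_exp_mul_norm_sq_gaussComplex (l := 1/2000) (by norm_num)]
    conv_rhs => rw [← map_pairing_of_unit x hx]
    rw [integral_map hmeas.aemeasurable
      (Measurable.aestronglyMeasurable (by fun_prop))]
  have hI : Integrable (fun a : Fin n → ℂ => Real.exp (1/2000 * ‖∑ j, a j * x j‖ ^ 2))
      (Measure.pi fun _ : Fin n => gaussComplex) :=
    .of_integral_ne_zero (by rw [hE]; norm_num)
  have := measure_pi_sum_ge_le (X := fun a : Fin n → ℂ => 1/2000 * ‖∑ j, a j * x j‖ ^ 2)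
    hI (b := 1/2000 + (1/2000) ^ 2)
    (hE.trans_le (inv_one_sub_le_exp (by norm_num) (by norm_num))) m (1/2000 * (1.001 * m))
  rw [gaussMatrixComplex_eq_pi]
  refine le_trans (measure_mono ?_) (this.trans (ENNReal.ofReal_le_ofReal
    (Real.exp_le_exp.2 ?_)))
  · intro A hA
    simp only [Set.mem_ofPred_eq] at hA ⊢
    rw [← Finset.mul_sum]
    linarith
  · have : (0 : ℝ) ≤ m := m.cast_nonneg
    norm_num
    nlinarith

lemma exp_neg_le_quadratic {t : ℝ} (ht : 0 ≤ t) : Real.exp (-t) ≤ 1 - t + t ^ 2 / 2 := by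
  have h2 := Real.quadratic_le_exp_of_nonneg ht
  have h3 : 0 < 1 + t + t ^ 2 / 2 := by positivity
  rw [Real.exp_neg, inv_le_iff_one_le_mul₀ (Real.exp_pos t)]
  have h4 : 0 < 1 - t + t ^ 2 / 2 := by nlinarith [sq_nonneg (t - 1)]
  calc (1 : ℝ) ≤ (1 - t + t ^ 2 / 2) * (1 + t + t ^ 2 / 2) := by nlinarith [sq_nonneg (t ^ 2)]
    _ ≤ _ := by gcongr

lemma exp_neg_difference_le {p q : ℝ} (a b : ℝ)
    (hpq : p ^ 2 + q ^ 2 = 1) {l : ℝ} (hl : 0 ≤ l) :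
    Real.exp (-(l * (p * a - q * b) ^ 2)) ≤
      1 - l * (p ^ 2 * a ^ 2 + q ^ 2 * b ^ 2 - 2 * p * q * (a * b)) + l ^ 2 * (a ^ 4 + b ^ 4) := by
  refine (exp_neg_le_quadratic (by positivity)).trans ?_
  have h1 : (p * a - q * b) ^ 2 ≤ a ^ 2 + b ^ 2 := by nlinarith [sq_nonneg (q * a + p * b)]
  have h2 : ((p * a - q * b) ^ 2) ^ 2 ≤ 2 * (a ^ 4 + b ^ 4) := by
    calc ((p * a - q * b) ^ 2) ^ 2 ≤ (a ^ 2 + b ^ 2) ^ 2 := by gcongr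
      _ ≤ _ := by nlinarith [sq_nonneg (a ^ 2 - b ^ 2)]
  nlinarith [mul_le_mul_of_nonneg_left h2 (sq_nonneg l)]

lemma integral_exp_neg_difference_le {p q : ℝ} (hpq : p ^ 2 + q ^ 2 = 1) {l : ℝ} (hl : 0 ≤ l) :
    ∫ z : ℂ × ℂ, Real.exp (-(l * (p * ‖z.1‖ - q * ‖z.2‖) ^ 2)) ∂(gaussComplex.prod gaussComplex)
      ≤ Real.exp (-(l * (1 - π / 4)) + 4 * l ^ 2) := by
  set μ := gaussComplex.prod gaussComplex
  have i1 : Integrable (fun z : ℂ × ℂ => ‖z.1‖ ^ 2) μ := integrable_norm_sq_gaussComplex.comp_fst _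
  have i2 : Integrable (fun z : ℂ × ℂ => ‖z.2‖ ^ 2) μ := integrable_norm_sq_gaussComplex.comp_snd _
  have i3 : Integrable (fun z : ℂ × ℂ => ‖z.1‖ ^ 4) μ :=
    integrable_norm_pow_four_gaussComplex.comp_fst _
  have i4 : Integrable (fun z : ℂ × ℂ => ‖z.2‖ ^ 4) μ :=
    integrable_norm_pow_four_gaussComplex.comp_snd _
  have i5 : Integrable (fun z : ℂ × ℂ => ‖z.1‖ * ‖z.2‖) μ :=
    integrable_norm_gaussComplex.mul_prod integrable_norm_gaussComplex
  have e1 : ∫ z : ℂ × ℂ, ‖z.1‖ ^ 2 ∂μ = 1 := by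
    simp [μ, integral_fun_fst (fun z : ℂ => ‖z‖ ^ 2), integral_norm_sq_gaussComplex]
  have e2 : ∫ z : ℂ × ℂ, ‖z.2‖ ^ 2 ∂μ = 1 := by
    simp [μ, integral_fun_snd (fun z : ℂ => ‖z‖ ^ 2), integral_norm_sq_gaussComplex]
  have e3 : ∫ z : ℂ × ℂ, ‖z.1‖ ^ 4 ∂μ = 2 := by
    simp [μ, integral_fun_fst (fun z : ℂ => ‖z‖ ^ 4), integral_norm_pow_four_gaussComplex]
  have e4 : ∫ z : ℂ × ℂ, ‖z.2‖ ^ 4 ∂μ = 2 := by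
    simp [μ, integral_fun_snd (fun z : ℂ => ‖z‖ ^ 4), integral_norm_pow_four_gaussComplex]
  have e5 : ∫ z : ℂ × ℂ, ‖z.1‖ * ‖z.2‖ ∂μ = π / 4 := by
    rw [integral_prod_mul (fun z : ℂ => ‖z‖) (fun z : ℂ => ‖z‖), integral_norm_gaussComplex,
      div_mul_div_comm, Real.mul_self_sqrt Real.pi_pos.le]
    norm_num
  have iA : Integrable (fun z : ℂ × ℂ => p ^ 2 * ‖z.1‖ ^ 2 + q ^ 2 * ‖z.2‖ ^ 2
      - 2 * p * q * (‖z.1‖ * ‖z.2‖)) μ :=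
    ((i1.const_mul _).add (i2.const_mul _)).sub (i5.const_mul _)
  have iC : Integrable (fun z : ℂ × ℂ => 1 - l * (p ^ 2 * ‖z.1‖ ^ 2 + q ^ 2 * ‖z.2‖ ^ 2
      - 2 * p * q * (‖z.1‖ * ‖z.2‖))) μ := (integrable_const 1).sub (iA.const_mul l)
  have iD : Integrable (fun z : ℂ × ℂ => p ^ 2 * ‖z.1‖ ^ 2 + q ^ 2 * ‖z.2‖ ^ 2) μ :=
    (i1.const_mul _).add (i2.const_mul _)
  have iB : Integrable (fun z : ℂ × ℂ => ‖z.1‖ ^ 4 + ‖z.2‖ ^ 4) μ := i3.add i4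
  have iR : Integrable (fun z : ℂ × ℂ => 1 - l * (p ^ 2 * ‖z.1‖ ^ 2 + q ^ 2 * ‖z.2‖ ^ 2
      - 2 * p * q * (‖z.1‖ * ‖z.2‖)) + l ^ 2 * (‖z.1‖ ^ 4 + ‖z.2‖ ^ 4)) μ :=
    iC.add (iB.const_mul _)
  have hpt := fun z : ℂ × ℂ => exp_neg_difference_le ‖z.1‖ ‖z.2‖ hpq hl
  have h1 := integral_mono_of_nonneg (μ := μ)
    (ae_of_all _ fun z => (Real.exp_pos (-(l * (p * ‖z.1‖ - q * ‖z.2‖) ^ 2))).le) iR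
    (ae_of_all _ hpt)
  refine h1.trans ?_
  rw [integral_add iC (iB.const_mul _),
    integral_sub (integrable_const 1) (iA.const_mul l), integral_const_mul, integral_const_mul,
    integral_add i3 i4, integral_sub iD (i5.const_mul _),
    integral_add (i1.const_mul _) (i2.const_mul _), integral_const_mul, integral_const_mul,
    integral_const_mul, e1, e2, e3, e4, e5]
  have h2 : 2 * p * q ≤ 1 := by nlinarith [sq_nonneg (p - q)]
  have h3 : 2 * p * q * (π / 4) ≤ π / 4 := by nlinarith [Real.pi_pos]
  have h4 := Real.add_one_le_exp (-(l * (1 - π / 4)) + 4 * l ^ 2)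
  have h5 := mul_le_mul_of_nonneg_left h3 hl
  simp only [integral_const, probReal_univ, smul_eq_mul, one_mul]
  nlinarith

/-- Lower tail of `‖|Ax| - |Ay|‖²` for orthogonal `x, y` with `‖x‖² + ‖y‖² = 1`. -/
lemma lower_tail {n : ℕ} (m : ℕ) (x y : Fin n → ℂ)
    (hxy : ∑ j, x j * (starRingEnd ℂ) (y j) = 0) (h1 : ∑ j, ‖x j‖ ^ 2 + ∑ j, ‖y j‖ ^ 2 = 1) :
    gaussMatrixComplex m n {A | ∑ i, (‖∑ j, A i j * x j‖ - ‖∑ j, A i j * y j‖) ^ 2 ≤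
        (1 - 1 / 2000) * (1 - π / 4) * m}
      ≤ ENNReal.ofReal (Real.exp (-(0.0000000005) * m)) := by
  set p := Real.sqrt (∑ j, ‖x j‖ ^ 2) with hp
  set q := Real.sqrt (∑ j, ‖y j‖ ^ 2) with hq
  have hp2 : p ^ 2 = ∑ j, ‖x j‖ ^ 2 := Real.sq_sqrt (by positivity)
  have hq2 : q ^ 2 = ∑ j, ‖y j‖ ^ 2 := Real.sq_sqrt (by positivity)
  have hmap := map_pairing_of_orthogonal x y hxy p q hp2 hq2
  have hp0 : 0 ≤ p := Real.sqrt_nonneg _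
  have hq0 : 0 ≤ q := Real.sqrt_nonneg _
  have hE : ∫ a : Fin n → ℂ,
      Real.exp (-(0.00001 * (‖∑ j, a j * x j‖ - ‖∑ j, a j * y j‖) ^ 2))
      ∂(Measure.pi fun _ : Fin n => gaussComplex)
      = ∫ z : ℂ × ℂ, Real.exp (-(0.00001 * (p * ‖z.1‖ - q * ‖z.2‖) ^ 2))
        ∂(gaussComplex.prod gaussComplex) := by
    have e1 := integral_map (μ := Measure.pi fun _ : Fin n => gaussComplex)
      (φ := fun a => (∑ j, a j * x j, ∑ j, a j * y j)) (by fun_prop)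
      (f := fun z : ℂ × ℂ => Real.exp (-(0.00001 * (‖z.1‖ - ‖z.2‖) ^ 2)))
      (Measurable.aestronglyMeasurable (by fun_prop))
    have e2 := integral_map (μ := gaussComplex.prod gaussComplex)
      (φ := fun z => ((p : ℂ) * z.1, (q : ℂ) * z.2)) (by fun_prop)
      (f := fun z : ℂ × ℂ => Real.exp (-(0.00001 * (‖z.1‖ - ‖z.2‖) ^ 2)))
      (Measurable.aestronglyMeasurable (by fun_prop))
    rw [← e1, hmap, e2]
    simp [abs_of_nonneg hp0, abs_of_nonneg hq0]
  have hI : Integrable (fun a : Fin n → ℂ =>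
      Real.exp (-(0.00001 * (‖∑ j, a j * x j‖ - ‖∑ j, a j * y j‖) ^ 2)))
      (Measure.pi fun _ : Fin n => gaussComplex) := by
    refine Integrable.mono' (integrable_const 1)
      (Measurable.aestronglyMeasurable (by fun_prop)) (ae_of_all _ fun a => ?_)
    rw [Real.norm_of_nonneg (Real.exp_pos _).le, Real.exp_le_one_iff]
    have := sq_nonneg (‖∑ j, a j * x j‖ - ‖∑ j, a j * y j‖)
    linarith
  have hb := integral_exp_neg_difference_le (p := p) (q := q) (by rw [hp2, hq2, h1])
    (l := 0.00001) (by norm_num)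
  have := measure_pi_sum_ge_le
    (X := fun a : Fin n → ℂ => -(0.00001 * (‖∑ j, a j * x j‖ - ‖∑ j, a j * y j‖) ^ 2))
    hI (hE.trans_le hb) m (-(0.00001 * ((1 - 1 / 2000) * (1 - π / 4) * m)))
  rw [gaussMatrixComplex_eq_pi]
  refine le_trans (measure_mono ?_) (this.trans (ENNReal.ofReal_le_ofReal
    (Real.exp_le_exp.2 ?_)))
  · intro A hA
    simp only [Set.mem_ofPred_eq] at hA ⊢
    rw [Finset.sum_neg_distrib, ← Finset.mul_sum]
    linarith
  · have hm : (0 : ℝ) ≤ m := m.cast_nonneg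
    have hpi : 1 / 5 ≤ 1 - π / 4 := by linarith [Real.pi_lt_d2]
    have := mul_le_mul_of_nonneg_left hpi hm
    norm_num at this ⊢
    nlinarith

open Module in
/-- Volumetric bound for the cardinality of a separated subset of the unit ball. -/
lemma card_le_of_separated {E : Type*} [NormedAddCommGroup E] [NormedSpace ℝ E]
    [FiniteDimensional ℝ E] {η : ℝ} (h0 : 0 < η) (h1 : η ≤ 1) (s : Finset E)
    (hs : ∀ c ∈ s, ‖c‖ ≤ 1) (h : ∀ c ∈ s, ∀ d ∈ s, c ≠ d → η ≤ ‖c - d‖) :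
    (s.card : ℝ) ≤ (3 / η) ^ finrank ℝ E := by
  borelize E
  let μ : Measure E := Measure.addHaar
  have hη : 0 < η / 2 := by positivity
  have hD : Set.PairwiseDisjoint (s : Set E) (fun c => Metric.ball c (η / 2)) := by
    intro c hc d hd hcd
    apply Metric.ball_disjoint_ball
    rw [dist_eq_norm]
    linarith [h c hc d hd hcd]
  have hsub : (⋃ c ∈ s, Metric.ball c (η / 2)) ⊆ Metric.ball (0 : E) (3 / 2) := by
    refine Set.iUnion₂_subset fun x hx => Metric.ball_subset_ball' ?_
    rw [dist_zero_right]
    linarith [hs x hx]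
  have hI : (s.card : ENNReal) * ENNReal.ofReal ((η / 2) ^ finrank ℝ E) * μ (Metric.ball 0 1) ≤
      ENNReal.ofReal ((3 / 2) ^ finrank ℝ E) * μ (Metric.ball 0 1) :=
    calc
      _ = μ (⋃ c ∈ s, Metric.ball c (η / 2)) := by
        rw [measure_biUnion_finset hD fun c _ => measurableSet_ball]
        simp only [μ.addHaar_ball_of_pos _ hη]
        simp only [Finset.sum_const, nsmul_eq_mul, mul_assoc]
      _ ≤ μ (Metric.ball (0 : E) (3 / 2)) := measure_mono hsub
      _ = _ := by rw [μ.addHaar_ball_of_pos _ (by norm_num)]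
  have hJ : (s.card : ENNReal) * ENNReal.ofReal ((η / 2) ^ finrank ℝ E) ≤
      ENNReal.ofReal ((3 / 2) ^ finrank ℝ E) :=
    (ENNReal.mul_le_mul_iff_left (Metric.measure_ball_pos _ _ zero_lt_one).ne'
      measure_ball_lt_top.ne).1 hI
  have hK := ENNReal.toReal_le_of_le_ofReal (by positivity) hJ
  rw [ENNReal.toReal_mul, ENNReal.toReal_natCast, ENNReal.toReal_ofReal (by positivity)] at hK
  rw [show (3 / η) = (3 / 2) / (η / 2) by field_simp, div_pow, le_div_iff₀ (by positivity)]
  exact hK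

open Module in
/-- Every subset of the unit ball has an `η`-net of cardinality at most `(3/η)^dim`. -/
lemma exists_net {E : Type*} [NormedAddCommGroup E] [NormedSpace ℝ E]
    [FiniteDimensional ℝ E] {η : ℝ} (h0 : 0 < η) (h1 : η ≤ 1) (S : Set E)
    (hS : ∀ c ∈ S, ‖c‖ ≤ 1) :
    ∃ s : Finset E, (∀ c ∈ s, c ∈ S) ∧ (∀ x ∈ S, ∃ c ∈ s, ‖x - c‖ ≤ η) ∧
      (s.card : ℝ) ≤ (3 / η) ^ finrank ℝ E := by
  classical
  let P : ℕ → Prop := fun k => ∃ s : Finset E, (∀ c ∈ s, c ∈ S) ∧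
    (∀ c ∈ s, ∀ d ∈ s, c ≠ d → η ≤ ‖c - d‖) ∧ s.card = k
  have hbound : ∀ s : Finset E, (∀ c ∈ s, c ∈ S) →
      (∀ c ∈ s, ∀ d ∈ s, c ≠ d → η ≤ ‖c - d‖) → (s.card : ℝ) ≤ (3 / η) ^ finrank ℝ E :=
    fun s hs hd => card_le_of_separated h0 h1 s (fun c hc => hS c (hs c hc)) hd
  set B := ⌊(3 / η) ^ finrank ℝ E⌋₊
  have hP : P (Nat.findGreatest P B) :=
    Nat.findGreatest_spec (zero_le) ⟨∅, by simp, by simp, rfl⟩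
  obtain ⟨s, hs, hd, hc⟩ := hP
  refine ⟨s, hs, fun x hx => ?_, hbound s hs hd⟩
  by_contra! hcon
  have hxs : x ∉ s := fun hxs => by
    have := hcon x hxs
    rw [sub_self, norm_zero] at this
    linarith
  have hs' : ∀ c ∈ insert x s, c ∈ S := by
    intro c hc
    rcases Finset.mem_insert.1 hc with rfl | hc
    exacts [hx, hs c hc]
  have hd' : ∀ c ∈ insert x s, ∀ d ∈ insert x s, c ≠ d → η ≤ ‖c - d‖ := by
    intro c hc d hd1 hcd
    rcases Finset.mem_insert.1 hc with h3 | h3 <;> rcases Finset.mem_insert.1 hd1 with h4 | h4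
    · exact absurd (h3.trans h4.symm) hcd
    · rw [h3]; exact (hcon d h4).le
    · rw [h4, norm_sub_rev]; exact (hcon c h3).le
    · exact hd c h3 d h4 hcd
  have h2 : (insert x s).card ≤ Nat.findGreatest P B :=
    Nat.le_findGreatest (Nat.le_floor (hbound _ hs' hd')) ⟨_, hs', hd', rfl⟩
  rw [Finset.card_insert_of_notMem hxs] at h2
  omega

/-- The entrywise modulus of a Euclidean vector. -/
noncomputable def absVec {m : ℕ} (w : EuclideanSpace ℂ (Fin m)) : EuclideanSpace ℝ (Fin m) :=
  WithLp.toLp 2 fun i => ‖w i‖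

lemma norm_absVec_sub_sq {m : ℕ} (w w' : EuclideanSpace ℂ (Fin m)) :
    ‖absVec w - absVec w'‖ ^ 2 = ∑ i, (‖w i‖ - ‖w' i‖) ^ 2 := by
  rw [EuclideanSpace.norm_sq_eq]
  simp [absVec]

lemma norm_absVec_sub_le {m : ℕ} (w w' : EuclideanSpace ℂ (Fin m)) :
    ‖absVec w - absVec w'‖ ≤ ‖w - w'‖ := by
  refine le_of_sq_le_sq ?_ (norm_nonneg _)
  rw [norm_absVec_sub_sq, EuclideanSpace.norm_sq_eq]
  refine Finset.sum_le_sum fun i _ => ?_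
  rw [PiLp.sub_apply, ← sq_abs]
  exact pow_le_pow_left₀ (abs_nonneg _) (abs_norm_sub_norm_le _ _) 2

lemma absVec_smul {m : ℕ} (c : ℝ) (w : EuclideanSpace ℂ (Fin m)) :
    absVec (c • w) = |c| • absVec w := by
  ext i
  simp [absVec]

lemma absVec_smul_of_norm_eq_one {m : ℕ} {c : ℂ} (hc : ‖c‖ = 1) (w : EuclideanSpace ℂ (Fin m)) :
    absVec (c • w) = absVec w := by
  ext i
  simp [absVec, hc]

/-- The real space of complex vectors supported in `T`. -/
def supportedIn {n : ℕ} (T : Finset (Fin n)) : Submodule ℝ (EuclideanSpace ℂ (Fin n)) where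
  carrier := {x | ∀ j, j ∉ T → x j = 0}
  add_mem' := fun hx hy j hj => by simp [hx j hj, hy j hj]
  zero_mem' := fun j _ => by simp
  smul_mem' := fun c x hx j hj => by simp [hx j hj]

lemma finrank_supportedIn_le {n : ℕ} (T : Finset (Fin n)) :
    Module.finrank ℝ (supportedIn T) ≤ 2 * T.card := by
  let f : supportedIn T →ₗ[ℝ] (T → ℂ) :=
    { toFun := fun x j => (x : EuclideanSpace ℂ (Fin n)) j
      map_add' := fun x y => by ext j; simp
      map_smul' := fun c x => by ext j; simp }
  have hf : Function.Injective f := by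
    intro x y hxy
    ext j
    by_cases hj : j ∈ T
    · exact congrFun hxy ⟨j, hj⟩
    · rw [x.2 j hj, y.2 j hj]
  have := LinearMap.finrank_le_finrank_of_injective hf
  rw [Module.finrank_pi_fintype] at this
  simpa [Complex.finrank_real_complex, mul_comm] using this

lemma norm_le_of_net {V W : Type*} [NormedAddCommGroup V] [NormedSpace ℝ V]
    [FiniteDimensional ℝ V] [NormedAddCommGroup W] [NormedSpace ℝ W] (f : V →ₗ[ℝ] W)
    {η a : ℝ} (hη : η < 1) (ha : 0 ≤ a) (s : Finset V)
    (hs : ∀ x : V, ‖x‖ = 1 → ∃ c ∈ s, ‖x - c‖ ≤ η) (hf : ∀ c ∈ s, ‖f c‖ ≤ a) (x : V) :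
    ‖f x‖ ≤ a / (1 - η) * ‖x‖ := by
  by_cases htriv : ∀ x : V, x = 0
  · rw [htriv x]; simp
  push Not at htriv
  obtain ⟨v, hv⟩ := htriv
  set F := LinearMap.toContinuousLinearMap f
  have hunit : ∀ x : V, x ≠ 0 → ‖(‖x‖⁻¹ • x)‖ = 1 := fun x hx => by
    rw [norm_smul, norm_inv, norm_norm, inv_mul_cancel₀ (norm_ne_zero_iff.2 hx)]
  have hη0 : 0 ≤ η := by
    obtain ⟨c, _, hc⟩ := hs _ (hunit v hv)
    exact (norm_nonneg _).trans hc
  have key : ‖F‖ ≤ a + ‖F‖ * η := by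
    refine F.opNorm_le_of_unit_norm (by positivity) fun x hx => ?_
    obtain ⟨c, hc, hxc⟩ := hs x hx
    calc ‖F x‖ = ‖F c + F (x - c)‖ := by rw [← map_add]; simp
      _ ≤ ‖F c‖ + ‖F (x - c)‖ := norm_add_le _ _
      _ ≤ a + ‖F‖ * η := by
        gcongr
        · exact hf c hc
        · exact (F.le_opNorm _).trans (by gcongr)
  have h1 : ‖F‖ ≤ a / (1 - η) := by
    rw [le_div_iff₀ (by linarith)]; linarith
  exact (F.le_opNorm x).trans (by gcongr)

/-- Uniform upper and lower bounds of a measurement matrix on vectors supported in `T`. -/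
def GoodOn {m n : ℕ} (A : Fin m → Fin n → ℂ) (T : Finset (Fin n)) : Prop :=
  (∀ x ∈ supportedIn T, ‖Matrix.toEuclideanLin (Matrix.of A) x‖ ≤ 1.001 * √m * ‖x‖) ∧
  ∀ x ∈ supportedIn T, ∀ y ∈ supportedIn T, inner ℂ x y = 0 →
    0.999 * √(1 - π / 4) * √m * √(‖x‖ ^ 2 + ‖y‖ ^ 2) ≤
      ‖absVec (Matrix.toEuclideanLin (Matrix.of A) x) -
        absVec (Matrix.toEuclideanLin (Matrix.of A) y)‖

lemma toEuclideanLin_of_apply {m n : ℕ} (A : Fin m → Fin n → ℂ) (x : EuclideanSpace ℂ (Fin n))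
    (i : Fin m) : Matrix.toEuclideanLin (Matrix.of A) x i = ∑ j, A i j * x j := by
  simp [Matrix.toEuclideanLin, Matrix.mulVec, dotProduct]

lemma goodOn_of_nets {m n : ℕ} (A : Fin m → Fin n → ℂ) (T : Finset (Fin n))
    (s : Finset (supportedIn T)) (t : Finset (supportedIn T × supportedIn T))
    (hs : ∀ x : supportedIn T, ‖x‖ = 1 → ∃ c ∈ s, ‖x - c‖ ≤ 0.0001)
    (ht : ∀ x y : supportedIn T, inner ℂ (x : EuclideanSpace ℂ (Fin n)) y = 0 →
      ‖x‖ ^ 2 + ‖y‖ ^ 2 = 1 → ∃ c ∈ t, ‖(x, y) - c‖ ≤ 0.0001)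
    (hs' : ∀ c ∈ s, ∑ i, ‖∑ j, A i j * (c : EuclideanSpace ℂ (Fin n)) j‖ ^ 2 ≤ 1.001 * m)
    (ht' : ∀ c ∈ t, (1 - 1 / 2000) * (1 - π / 4) * m ≤
      ∑ i, (‖∑ j, A i j * (c.1 : EuclideanSpace ℂ (Fin n)) j‖
        - ‖∑ j, A i j * (c.2 : EuclideanSpace ℂ (Fin n)) j‖) ^ 2) :
    GoodOn A T := by
  set Φ := Matrix.toEuclideanLin (Matrix.of A)
  have hsq : √m ^ 2 = (m : ℝ) := Real.sq_sqrt m.cast_nonneg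
  have hs0 : 0 ≤ √(m : ℝ) := Real.sqrt_nonneg _
  let f : supportedIn T →ₗ[ℝ] EuclideanSpace ℂ (Fin m) :=
    (Φ.restrictScalars ℝ).comp (supportedIn T).subtype
  have hf : ∀ c ∈ s, ‖f c‖ ≤ 1.0005 * √m := by
    intro c hc
    refine le_of_sq_le_sq ?_ (by positivity)
    rw [EuclideanSpace.norm_sq_eq]
    have := hs' c hc
    simp_rw [← toEuclideanLin_of_apply] at this
    refine le_trans this ?_
    rw [mul_pow, hsq]
    have : (0 : ℝ) ≤ m := m.cast_nonneg
    nlinarith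
  have hup : ∀ x : supportedIn T, ‖Φ x‖ ≤ 1.001 * √m * ‖x‖ := by
    intro x
    refine (norm_le_of_net f (η := 0.0001) (by norm_num) (by positivity) s hs hf x).trans ?_
    gcongr
    rw [div_le_iff₀ (by norm_num)]
    nlinarith
  refine ⟨fun x hx => hup ⟨x, hx⟩, ?_⟩
  have hμ : 0.21 ≤ 1 - π / 4 := by linarith [Real.pi_lt_d2]
  have hμ' : 0.4 ≤ √(1 - π / 4) := Real.le_sqrt_of_sq_le (by linarith)
  have hμ2 : √(1 - π / 4) ^ 2 = 1 - π / 4 := Real.sq_sqrt (by linarith)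
  have hunit : ∀ x y : supportedIn T, inner ℂ (x : EuclideanSpace ℂ (Fin n)) y = 0 →
      ‖x‖ ^ 2 + ‖y‖ ^ 2 = 1 → 0.999 * √(1 - π / 4) * √m ≤ ‖absVec (Φ x) - absVec (Φ y)‖ := by
    intro x y hxy h1
    obtain ⟨c, hc, hd⟩ := ht x y hxy h1
    have hd1 : ‖x - c.1‖ ≤ 0.0001 := (norm_fst_le ((x, y) - c)).trans hd
    have hd2 : ‖y - c.2‖ ≤ 0.0001 := (norm_snd_le ((x, y) - c)).trans hd
    have hp : ∀ u v : supportedIn T, ‖u - v‖ ≤ 0.0001 →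
        ‖absVec (Φ u) - absVec (Φ v)‖ ≤ 0.0001001 * √m := by
      intro u v huv
      refine (norm_absVec_sub_le _ _).trans ?_
      rw [← map_sub]
      refine (hup (u - v)).trans ?_
      nlinarith
    have h2 : 0.9997 * √(1 - π / 4) * √m ≤ ‖absVec (Φ c.1) - absVec (Φ c.2)‖ := by
      refine le_of_sq_le_sq ?_ (norm_nonneg _)
      rw [norm_absVec_sub_sq, mul_pow, mul_pow, hsq, hμ2]
      have := ht' c hc
      simp_rw [← toEuclideanLin_of_apply] at this
      refine le_trans ?_ this
      gcongr
      norm_num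
    have h3 : ‖absVec (Φ c.1) - absVec (Φ c.2)‖ ≤ ‖absVec (Φ x) - absVec (Φ c.1)‖ +
        ‖absVec (Φ x) - absVec (Φ y)‖ + ‖absVec (Φ y) - absVec (Φ c.2)‖ := by
      calc _ = ‖-(absVec (Φ x) - absVec (Φ c.1)) + (absVec (Φ x) - absVec (Φ y)) +
            (absVec (Φ y) - absVec (Φ c.2))‖ := by congr 1; abel
        _ ≤ _ := by
          refine (norm_add_le _ _).trans ?_
          gcongr
          refine (norm_add_le _ _).trans ?_
          rw [norm_neg]
    have h4 := hp x c.1 hd1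
    have h5 := hp y c.2 hd2
    nlinarith [mul_le_mul_of_nonneg_right hμ' hs0]
  intro x hx y hy hxy
  set ρ := √(‖x‖ ^ 2 + ‖y‖ ^ 2) with hρ
  have hρ2 : ρ ^ 2 = ‖x‖ ^ 2 + ‖y‖ ^ 2 := Real.sq_sqrt (by positivity)
  rcases (show 0 ≤ ρ from Real.sqrt_nonneg _).eq_or_lt with h0 | h0
  · rw [← h0, mul_zero]; exact norm_nonneg _
  have h1 := hunit (ρ⁻¹ • ⟨x, hx⟩) (ρ⁻¹ • ⟨y, hy⟩)
    (by
      change inner ℂ (ρ⁻¹ • x) (ρ⁻¹ • y) = 0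
      rw [← Complex.coe_smul, ← Complex.coe_smul, inner_smul_left, inner_smul_right, hxy]
      simp)
    (by
      rw [norm_smul, norm_smul, mul_pow, mul_pow, ← mul_add, Real.norm_of_nonneg (by positivity)]
      change ρ⁻¹ ^ 2 * (‖x‖ ^ 2 + ‖y‖ ^ 2) = 1
      rw [← hρ2, ← mul_pow, inv_mul_cancel₀ h0.ne', one_pow])
  have e : ∀ z (hz : z ∈ supportedIn T), Φ ((ρ⁻¹ • (⟨z, hz⟩ : supportedIn T) : supportedIn T) :
      EuclideanSpace ℂ (Fin n)) = ρ⁻¹ • Φ z := by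
    intro z hz
    exact (Φ.restrictScalars ℝ).map_smul ρ⁻¹ z
  rw [e, e, absVec_smul, absVec_smul, ← smul_sub, norm_smul, Real.norm_of_nonneg (abs_nonneg _),
    abs_of_pos (inv_pos.2 h0)] at h1
  rw [← div_eq_inv_mul, le_div_iff₀ h0] at h1
  exact h1

lemma measure_biUnion_finset_le_card_mul {α β : Type*} [MeasurableSpace α] (μ : Measure α)
    (s : Finset β) (B : β → Set α) {ε : ENNReal} (h : ∀ c ∈ s, μ (B c) ≤ ε) :
    μ (⋃ c ∈ s, B c) ≤ s.card * ε := by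
  refine (measure_biUnion_finset_le s B).trans ?_
  rw [← nsmul_eq_mul]
  exact Finset.sum_le_card_nsmul s _ _ h

lemma measure_not_goodOn_le {m n : ℕ} (T : Finset (Fin n)) {d : ℕ} (hT : T.card ≤ d) :
    gaussMatrixComplex m n {A | ¬ GoodOn A T} ≤
      ENNReal.ofReal (2 * 30000 ^ (4 * d) * Real.exp (-(0.0000000005) * m)) := by
  have hr := finrank_supportedIn_le T
  obtain ⟨s, hsS, hs, hsc⟩ := exists_net (E := supportedIn T) (η := 0.0001) (by norm_num)
    (by norm_num) {x | ‖x‖ = 1} (fun c hc => le_of_eq hc)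
  obtain ⟨t, htS, ht, htc⟩ := exists_net (E := supportedIn T × supportedIn T) (η := 0.0001)
    (by norm_num) (by norm_num)
    {z | inner ℂ (z.1 : EuclideanSpace ℂ (Fin n)) z.2 = 0 ∧ ‖z.1‖ ^ 2 + ‖z.2‖ ^ 2 = 1}
    (fun c hc => by
      have h2 : ‖c.1‖ ^ 2 + ‖c.2‖ ^ 2 = 1 := hc.2
      rw [Prod.norm_def, max_le_iff]
      constructor <;> refine le_of_sq_le_sq ?_ zero_le_one <;>
        nlinarith [sq_nonneg ‖c.1‖, sq_nonneg ‖c.2‖])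
  rw [show (3 / 0.0001 : ℝ) = 30000 by norm_num] at hsc htc
  have hsc' : (s.card : ℝ) ≤ 30000 ^ (4 * d) :=
    hsc.trans (pow_le_pow_right₀ (by norm_num) (by omega))
  have htc' : (t.card : ℝ) ≤ 30000 ^ (4 * d) :=
    htc.trans (pow_le_pow_right₀ (by norm_num) (by rw [Module.finrank_prod]; omega))
  have b1 := measure_biUnion_finset_le_card_mul (gaussMatrixComplex m n) s
    (fun c => {A | 1.001 * m ≤ ∑ i, ‖∑ j, A i j * (c : EuclideanSpace ℂ (Fin n)) j‖ ^ 2})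
    (fun c hc => upper_tail m _ (by
      have h4 : ‖(c : EuclideanSpace ℂ (Fin n))‖ = 1 := hsS c hc
      rw [← EuclideanSpace.norm_sq_eq, h4, one_pow]))
  have b2 := measure_biUnion_finset_le_card_mul (gaussMatrixComplex m n) t
    (fun c => {A | ∑ i, (‖∑ j, A i j * (c.1 : EuclideanSpace ℂ (Fin n)) j‖
        - ‖∑ j, A i j * (c.2 : EuclideanSpace ℂ (Fin n)) j‖) ^ 2 ≤
          (1 - 1 / 2000) * (1 - π / 4) * m})
    (fun c hc => lower_tail m _ _ (by
      have h4 := (htS c hc).1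
      rw [← inner_conj_symm, PiLp.inner_apply, map_eq_zero] at h4
      rw [← h4]
      exact Finset.sum_congr rfl fun j _ => by simp) (by
      rw [← EuclideanSpace.norm_sq_eq, ← EuclideanSpace.norm_sq_eq]
      exact (htS c hc).2))
  refine ((measure_mono fun A hA => ?_).trans
    ((measure_union_le _ _).trans (add_le_add b1 b2))).trans ?_
  · by_contra hcon
    simp only [Set.mem_union, Set.mem_iUnion, Set.mem_ofPred_eq, not_or, not_exists,
      not_le] at hcon
    exact hA (goodOn_of_nets A T s t hs (fun x y h1 h2 => ht (x, y) ⟨h1, h2⟩)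
      (fun c hc => (hcon.1 c hc).le) (fun c hc => (hcon.2 c hc).le))
  rw [← add_mul, ENNReal.ofReal_mul (by positivity)]
  gcongr
  rw [← ENNReal.ofReal_natCast, ← ENNReal.ofReal_natCast,
    ← ENNReal.ofReal_add (by positivity) (by positivity)]
  exact ENNReal.ofReal_le_ofReal (by linarith)

/-- The number of subsets of `Fin n` of cardinality at most `d`. -/
lemma card_filter_card_le {n k : ℕ} (hk : 0 < k) (hkn : k ≤ n) (d : ℕ) :
    (((Finset.univ : Finset (Finset (Fin n))).filter fun T => T.card ≤ d).card : ℝ) ≤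
      Real.exp ((d + k) * Real.log (Real.exp 1 * n / k)) := by
  have hk' : (0 : ℝ) < k := by exact_mod_cast hk
  have hn' : (0 : ℝ) < n := by exact_mod_cast hk.trans_le hkn
  have hkn' : (k : ℝ) ≤ n := by exact_mod_cast hkn
  set l : ℝ := k / n
  have hl0 : 0 < l := by positivity
  have hl1 : l ≤ 1 := (div_le_one hn').2 hkn'
  set F := (Finset.univ : Finset (Finset (Fin n))).filter fun T => T.card ≤ d
  have hlog : Real.log (Real.exp 1 * n / k) = 1 - Real.log l := by
    rw [show Real.exp 1 * n / k = Real.exp 1 / l by simp only [l]; field_simp,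
      Real.log_div (Real.exp_pos 1).ne' hl0.ne', Real.log_exp]
  have h1 : (F.card : ℝ) * l ^ d ≤ Real.exp k := by
    calc (F.card : ℝ) * l ^ d = ∑ _T ∈ F, l ^ d := by rw [Finset.sum_const, nsmul_eq_mul]
      _ ≤ ∑ T ∈ F, l ^ T.card := Finset.sum_le_sum fun T hT =>
        pow_le_pow_of_le_one hl0.le hl1 (Finset.mem_filter.1 hT).2
      _ ≤ ∑ T : Finset (Fin n), l ^ T.card :=
        Finset.sum_le_sum_of_subset_of_nonneg (Finset.filter_subset _ _)
          fun _ _ _ => by positivity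
      _ = (l + 1) ^ n := by
        have := Finset.sum_pow_mul_eq_add_pow l 1 (Finset.univ : Finset (Fin n))
        simpa using this
      _ ≤ Real.exp l ^ n := by gcongr; exact Real.add_one_le_exp l
      _ = Real.exp k := by
        rw [← Real.exp_nat_mul]; congr 1; simp only [l]; field_simp
  have h2 : l ^ d = Real.exp (d * Real.log l) := by
    rw [Real.exp_nat_mul, Real.exp_log hl0]
  rw [h2, ← le_div_iff₀ (Real.exp_pos _), ← Real.exp_sub] at h1
  refine h1.trans (Real.exp_le_exp.2 ?_)
  rw [hlog]
  have h3 : Real.log l ≤ 0 := Real.log_nonpos hl0.le hl1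
  have : (0 : ℝ) ≤ d := d.cast_nonneg
  nlinarith

lemma measure_exists_not_goodOn_le {m n k : ℕ} (hk : 0 < k) (hkn : k ≤ n) (d : ℕ) :
    gaussMatrixComplex m n {A | ∃ T : Finset (Fin n), T.card ≤ d ∧ ¬ GoodOn A T} ≤
      ENNReal.ofReal (Real.exp ((d + k) * Real.log (Real.exp 1 * n / k)) *
        (2 * 30000 ^ (4 * d) * Real.exp (-(0.0000000005) * m))) := by
  have hset : {A : Fin m → Fin n → ℂ | ∃ T : Finset (Fin n), T.card ≤ d ∧ ¬ GoodOn A T} =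
      ⋃ T ∈ (Finset.univ : Finset (Finset (Fin n))).filter (fun T => T.card ≤ d),
        {A | ¬ GoodOn A T} := by
    ext A; simp
  rw [hset, ENNReal.ofReal_mul (Real.exp_pos _).le]
  refine (measure_biUnion_finset_le_card_mul _ _ _ fun T hT =>
    measure_not_goodOn_le T (Finset.mem_filter.1 hT).2).trans ?_
  gcongr
  rw [← ENNReal.ofReal_natCast]
  exact ENNReal.ofReal_le_ofReal (card_filter_card_le hk hkn d)

lemma union_bound_le {r : ℝ} (hr : 0 < r) {k d : ℕ} {l m : ℝ} (hk : 0 < k) (hl : 1 ≤ l)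
    (hd : (d : ℝ) ≤ 2 * (r + 4) * k)
    (hm : (2 * (r + 4) * (1 + 4 * Real.log 30000) + 2) / (0.0000000005 / 2) * k * l ≤ m) :
    Real.exp ((d + k) * l) * (2 * 30000 ^ (4 * d) * Real.exp (-(0.0000000005) * m)) ≤
      Real.exp (-(0.0000000005 / 2) * m) := by
  have hk' : (1 : ℝ) ≤ k := by exact_mod_cast hk
  have hK : 0 ≤ Real.log 30000 := Real.log_nonneg (by norm_num)
  have h1 : (30000 : ℝ) ^ (4 * d) = Real.exp (4 * d * Real.log 30000) := by
    have h := Real.exp_nat_mul (Real.log 30000) (4 * d)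
    rw [Real.exp_log (by norm_num)] at h
    rw [← h]
    push_cast
    rfl
  have h2 : (2 : ℝ) ≤ Real.exp 1 := by linarith [Real.add_one_le_exp 1]
  calc _ ≤ Real.exp ((d + k) * l) * (Real.exp 1 * Real.exp (4 * d * Real.log 30000) *
        Real.exp (-(0.0000000005) * m)) := by rw [h1]; gcongr
    _ = Real.exp ((d + k) * l + (1 + 4 * d * Real.log 30000 + -(0.0000000005) * m)) := by
      rw [Real.exp_add, Real.exp_add, Real.exp_add]
    _ ≤ _ := by
      refine Real.exp_le_exp.2 ?_
      have h3 : (2 * (r + 4) * (1 + 4 * Real.log 30000) + 2) * (k * l) ≤ 0.0000000005 / 2 * m := by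
        have := mul_le_mul_of_nonneg_left hm (show (0 : ℝ) ≤ 0.0000000005 / 2 by norm_num)
        refine le_of_eq_of_le ?_ this
        field_simp
      have h4 : (1 : ℝ) ≤ k * l := by nlinarith
      have h5 : (k : ℝ) ≤ k * l := by nlinarith
      have h6 : (d : ℝ) * l ≤ 2 * (r + 4) * (k * l) := by nlinarith
      have h7 : (d : ℝ) ≤ 2 * (r + 4) * (k * l) := hd.trans (by gcongr)
      have h8 := mul_le_mul_of_nonneg_right h7 hK
      nlinarith

lemma abs_norm_add_sub_norm_sub_le {τ : ℝ} (h0 : 0 ≤ τ) (h1 : τ ≤ 1) (u v : ℂ) :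
    (‖(τ : ℂ) * u + v‖ - ‖(τ : ℂ) * u - v‖) ^ 2 ≤ (‖u + v‖ - ‖u - v‖) ^ 2 := by
  have key : ∀ a : ℂ, (‖a + v‖ - ‖a - v‖) ^ 2 = 2 * (‖a‖ ^ 2 + ‖v‖ ^ 2) - 2 * ‖a ^ 2 - v ^ 2‖ := by
    intro a
    have e1 : ‖a ^ 2 - v ^ 2‖ = ‖a + v‖ * ‖a - v‖ := by rw [← norm_mul]; congr 1; ring
    have e2 := parallelogram_law_with_norm ℝ a v
    rw [e1]
    linarith
  rw [key, key]
  have h2 : ‖u ^ 2 - v ^ 2‖ ≤ ‖((τ : ℂ) * u) ^ 2 - v ^ 2‖ + (1 - τ ^ 2) * ‖u‖ ^ 2 := by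
    have e : u ^ 2 - v ^ 2 = (((τ : ℂ) * u) ^ 2 - v ^ 2) + ((1 - τ ^ 2 : ℝ) : ℂ) * u ^ 2 := by
      push_cast; ring
    rw [e]
    refine (norm_add_le _ _).trans (le_of_eq ?_)
    rw [norm_mul, norm_pow, Complex.norm_real, Real.norm_of_nonneg (by nlinarith)]
  have h3 : ‖(τ : ℂ) * u‖ = τ * ‖u‖ := by
    rw [norm_mul, Complex.norm_real, Real.norm_of_nonneg h0]
  rw [h3, mul_pow]
  linarith

lemma exists_unit_inner_eq_norm {n : ℕ} (x y : EuclideanSpace ℂ (Fin n)) :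
    ∃ c : ℂ, ‖c‖ = 1 ∧ inner ℂ x (c • y) = (‖inner ℂ x y‖ : ℂ) := by
  by_cases h : inner ℂ x y = 0
  · exact ⟨1, by simp, by simp [h]⟩
  · have hn : (‖inner ℂ x y‖ : ℂ) ≠ 0 := by simpa using h
    refine ⟨(starRingEnd ℂ) (inner ℂ x y) / ‖inner ℂ x y‖, ?_, ?_⟩
    · rw [norm_div, RCLike.norm_conj, Complex.norm_real, norm_norm,
        div_self (norm_ne_zero_iff.2 h)]
    · rw [inner_smul_right, div_mul_eq_mul_div, RCLike.conj_mul, sq]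
      exact mul_div_cancel_right₀ _ hn

lemma norm_absVec_map_add_sub_le {m n : ℕ}
    (Φ : EuclideanSpace ℂ (Fin n) →ₗ[ℂ] EuclideanSpace ℂ (Fin m)) {τ : ℝ} (h0 : 0 ≤ τ)
    (h1 : τ ≤ 1) (w h : EuclideanSpace ℂ (Fin n)) :
    ‖absVec (Φ ((τ : ℂ) • w + h)) - absVec (Φ ((τ : ℂ) • w - h))‖ ≤
      ‖absVec (Φ (w + h)) - absVec (Φ (w - h))‖ := by
  refine le_of_sq_le_sq ?_ (norm_nonneg _)
  rw [norm_absVec_sub_sq, norm_absVec_sub_sq]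
  refine Finset.sum_le_sum fun i _ => ?_
  simpa using abs_norm_add_sub_norm_sub_le h0 h1 (Φ w i) (Φ h i)

lemma GoodOn.lower {m n : ℕ} {A : Fin m → Fin n → ℂ} {T : Finset (Fin n)} (hA : GoodOn A T)
    {x y : EuclideanSpace ℂ (Fin n)} (hx : x ∈ supportedIn T) (hy : y ∈ supportedIn T) :
    ∃ c : ℂ, ‖c‖ = 1 ∧ 0.999 * √(1 - π / 4) * √m * ‖x - c • y‖ ≤
      ‖absVec (Matrix.toEuclideanLin (Matrix.of A) x) -
        absVec (Matrix.toEuclideanLin (Matrix.of A) y)‖ := by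
  set Φ := Matrix.toEuclideanLin (Matrix.of A) with hΦ
  obtain ⟨c, hc, hin⟩ := exists_unit_inner_eq_norm x y
  refine ⟨c, hc, ?_⟩
  set w := x + c • y with hw
  set h := x - c • y with hh
  have hin' : inner ℂ (c • y) x = (‖inner ℂ x y‖ : ℂ) := by
    rw [← inner_conj_symm, hin, Complex.conj_ofReal]
  have hwh : inner ℂ w h = inner ℂ h w := by
    simp only [hw, hh, inner_add_left, inner_add_right, inner_sub_left, inner_sub_right, hin, hin']
    ring
  have hle : ‖h‖ ≤ ‖w‖ := by
    refine le_of_sq_le_sq ?_ (norm_nonneg _)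
    rw [hw, hh, @norm_sub_sq ℂ, @norm_add_sq ℂ, hin]
    simp only [RCLike.re_to_complex, Complex.ofReal_re]
    linarith [norm_nonneg (inner ℂ x y)]
  rcases (norm_nonneg h).eq_or_lt with h0 | h0
  · rw [← h0, mul_zero]; exact norm_nonneg _
  have hw0 : 0 < ‖w‖ := h0.trans_le hle
  set τ := ‖h‖ / ‖w‖
  have hτ0 : 0 ≤ τ := by positivity
  have hτ1 : τ ≤ 1 := (div_le_one hw0).2 hle
  have hτw : τ * ‖w‖ = ‖h‖ := div_mul_cancel₀ _ hw0.ne'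
  have hcy : c • y ∈ supportedIn T := fun j hj => by simp [hy j hj]
  have hwT : w ∈ supportedIn T := add_mem hx hcy
  have hhT : h ∈ supportedIn T := sub_mem hx hcy
  have hτT : (τ : ℂ) • w ∈ supportedIn T := fun j hj => by simp [hwT j hj]
  have horth : inner ℂ ((τ : ℂ) • w + h) ((τ : ℂ) • w - h) = 0 := by
    simp only [inner_add_left, inner_sub_right, inner_smul_left, inner_smul_right,
      Complex.conj_ofReal, inner_self_eq_norm_sq_to_K, hwh]
    have : ((τ : ℂ) * ‖w‖) ^ 2 = (‖h‖ : ℂ) ^ 2 := by rw [← Complex.ofReal_mul, hτw]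
    simp only [Complex.coe_algebraMap]
    linear_combination this
  have hnorm : ‖(τ : ℂ) • w + h‖ ^ 2 + ‖(τ : ℂ) • w - h‖ ^ 2 = (2 * ‖h‖) ^ 2 := by
    have := parallelogram_law_with_norm ℂ ((τ : ℂ) • w) h
    rw [norm_smul, Complex.norm_real, Real.norm_of_nonneg hτ0, hτw] at this
    linarith
  have h1 := hA.2 _ (add_mem hτT hhT) _ (sub_mem hτT hhT) horth
  rw [hnorm, Real.sqrt_sq (by positivity), ← hΦ] at h1
  have h2 := h1.trans (norm_absVec_map_add_sub_le Φ hτ0 hτ1 w h)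
  have e1 : w + h = (2 : ℝ) • x := by rw [hw, hh, two_smul]; abel
  have e2 : w - h = (2 : ℝ) • c • y := by rw [hw, hh, two_smul]; abel
  have e3 : ∀ z, Φ ((2 : ℝ) • z) = (2 : ℝ) • Φ z := (Φ.restrictScalars ℝ).map_smul 2
  rw [e1, e2, e3, e3, map_smul, absVec_smul, absVec_smul, absVec_smul_of_norm_eq_one hc,
    ← smul_sub, norm_smul] at h2
  norm_num at h2 ⊢
  linarith

lemma GoodOn.upper {m n : ℕ} {A : Fin m → Fin n → ℂ} {T : Finset (Fin n)} (hA : GoodOn A T)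
    {x y : EuclideanSpace ℂ (Fin n)} (hx : x ∈ supportedIn T) (hy : y ∈ supportedIn T)
    {c : ℂ} (hc : ‖c‖ = 1) :
    ‖absVec (Matrix.toEuclideanLin (Matrix.of A) x) -
        absVec (Matrix.toEuclideanLin (Matrix.of A) y)‖ ≤ 1.001 * √m * ‖x - c • y‖ := by
  rw [← absVec_smul_of_norm_eq_one hc (Matrix.toEuclideanLin (Matrix.of A) y), ← map_smul]
  refine (norm_absVec_sub_le _ _).trans ?_
  rw [← map_sub]
  exact hA.1 _ (sub_mem hx fun j hj => by simp [hy j hj])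

lemma lpNorm_two_eq {ι 𝕜 : Type*} [Fintype ι] [RCLike 𝕜] (x : ι → 𝕜) :
    lpNorm 2 x = ‖(WithLp.toLp 2 x : EuclideanSpace 𝕜 ι)‖ := by
  rw [EuclideanSpace.norm_eq, _root_.lpNorm, Real.sqrt_eq_rpow]
  simp

lemma phaseDist_le {n : ℕ} (x y : Fin n → ℂ) {c : ℂ} (hc : ‖c‖ = 1) :
    phaseDist 2 x y ≤ ‖(WithLp.toLp 2 x : EuclideanSpace ℂ (Fin n)) - c • WithLp.toLp 2 y‖ := by
  refine csInf_le ⟨0, ?_⟩ ⟨c, hc, ?_⟩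
  · rintro _ ⟨c, _, rfl⟩
    rw [lpNorm_two_eq]
    exact norm_nonneg _
  · rw [lpNorm_two_eq]
    rfl

lemma le_phaseDist {n : ℕ} (x y : Fin n → ℂ) {b : ℝ} (hb : ∀ c : ℂ, ‖c‖ = 1 →
    b ≤ ‖(WithLp.toLp 2 x : EuclideanSpace ℂ (Fin n)) - c • WithLp.toLp 2 y‖) :
    b ≤ phaseDist 2 x y := by
  refine le_csInf ⟨_, 1, by simp, rfl⟩ ?_
  rintro _ ⟨c, hc, rfl⟩
  rw [lpNorm_two_eq]
  exact hb c hc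

lemma lpNorm_absMv_sub {m n : ℕ} (A : Fin m → Fin n → ℂ) (x y : Fin n → ℂ) :
    lpNorm 2 (fun i => absMv A x i - absMv A y i) =
      ‖absVec (Matrix.toEuclideanLin (Matrix.of A) (WithLp.toLp 2 x)) -
        absVec (Matrix.toEuclideanLin (Matrix.of A) (WithLp.toLp 2 y))‖ := by
  rw [lpNorm_two_eq]
  congr 1

lemma phaselessBiLip_of_goodOn {m n : ℕ} (hm : 0 < m) {A : Fin m → Fin n → ℂ} {R : ℝ}
    (hA : ∀ T : Finset (Fin n), T.card ≤ 2 * ⌊R⌋₊ → GoodOn A T) :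
    PhaselessBiLip A {z | (l0Norm z : ℝ) ≤ R} (0.999 * √(1 - π / 4) * √m) (1.001 * √m) := by
  classical
  intro x hx y hy
  let supp : (Fin n → ℂ) → Finset (Fin n) := fun z => Finset.univ.filter fun i => z i ≠ 0
  have hcard : ∀ z : Fin n → ℂ, (l0Norm z : ℝ) ≤ R → (supp z).card ≤ ⌊R⌋₊ := by
    intro z hz
    have : l0Norm z ≤ ⌊R⌋₊ := Nat.le_floor hz
    convert this
    unfold l0Norm
    congr
  have hT : (supp x ∪ supp y).card ≤ 2 * ⌊R⌋₊ := by
    have := Finset.card_union_le (supp x) (supp y)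
    have := hcard x hx
    have := hcard y hy
    omega
  have hG := hA _ hT
  have hxT : (WithLp.toLp 2 x : EuclideanSpace ℂ (Fin n)) ∈ supportedIn (supp x ∪ supp y) := by
    intro j hj
    by_contra hne
    exact hj (Finset.mem_union_left _ (by simpa [supp] using hne))
  have hyT : (WithLp.toLp 2 y : EuclideanSpace ℂ (Fin n)) ∈ supportedIn (supp x ∪ supp y) := by
    intro j hj
    by_contra hne
    exact hj (Finset.mem_union_right _ (by simpa [supp] using hne))
  have hs : 0 < √(m : ℝ) := Real.sqrt_pos.2 (by exact_mod_cast hm)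
  rw [lpNorm_absMv_sub]
  constructor
  · obtain ⟨c, hc, hlow⟩ := hG.lower hxT hyT
    refine le_trans ?_ hlow
    gcongr
    exact phaseDist_le x y hc
  · rw [← div_le_iff₀' (by positivity)]
    refine le_phaseDist x y fun c hc => ?_
    rw [div_le_iff₀' (by positivity)]
    exact hG.upper hxT hyT hc

/-- Theorem `th:lip`, complex case: a standard complex Gaussian random matrix
`A ∈ ℂ^{m×n}` with `m ≥ C·k·log(en/k)` satisfies, with probability at least `1 - exp(-c₀ m)`,
the phaseless bi-Lipschitz condition on `(r+4)k`-sparse vectors with constants `L, U` such that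
`√(4/(4-π)) ≤ U/L ≤ √(4/(4-π)) + 0.01`, where `C` depends only on `r`. -/
theorem stmt8 :
    ∃ c₀ : ℝ, 0 < c₀ ∧
      ∀ r : ℝ, 0 < r →
        ∃ C : ℝ, 0 < C ∧
          ∀ p : ℝ, 0 < p → p ≤ 1 →
            0 < 1 - (Real.sqrt (4 / (4 - π)) + 0.01) * 2 ^ (1 / p - 1)
                * (2 / r) ^ (1 / p - 1 / 2) →
            ∀ k n m : ℕ, 0 < k → k ≤ n →
              C * k * Real.log (Real.exp 1 * n / k) ≤ m →
              ENNReal.ofReal (1 - Real.exp (-c₀ * m)) ≤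
                gaussMatrixComplex m n
                  {A : Fin m → Fin n → ℂ | ∃ L U : ℝ, 0 < L ∧ 0 < U ∧
                    Real.sqrt (4 / (4 - π)) ≤ U / L ∧
                    U / L ≤ Real.sqrt (4 / (4 - π)) + 0.01 ∧
                    PhaselessBiLip A {z | (l0Norm z : ℝ) ≤ (r + 4) * k} L U} := by
  refine ⟨0.0000000005 / 2, by norm_num, fun r hr => ?_⟩
  have hK : 0 ≤ Real.log 30000 := Real.log_nonneg (by norm_num)
  refine ⟨(2 * (r + 4) * (1 + 4 * Real.log 30000) + 2) / (0.0000000005 / 2), by positivity, ?_⟩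
  intro _ _ _ _ k n m hk hkn hm
  have hk' : (0 : ℝ) < k := by exact_mod_cast hk
  have hl : 1 ≤ Real.log (Real.exp 1 * n / k) := by
    rw [Real.le_log_iff_exp_le (by have : 0 < n := hk.trans_le hkn; positivity), le_div_iff₀ hk']
    gcongr
  have hm0 : (0 : ℝ) < m := lt_of_lt_of_le (by positivity) hm
  have hR : 0 ≤ (r + 4) * k := by positivity
  set d := 2 * ⌊(r + 4) * k⌋₊ with hd
  have hd' : (d : ℝ) ≤ 2 * (r + 4) * k := by
    rw [hd]
    push_cast
    linarith [Nat.floor_le hR]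
  have hbad : gaussMatrixComplex m n {A | ∃ T : Finset (Fin n), T.card ≤ d ∧ ¬ GoodOn A T} ≤
      ENNReal.ofReal (Real.exp (-(0.0000000005 / 2) * m)) :=
    (measure_exists_not_goodOn_le hk hkn d).trans
      (ENNReal.ofReal_le_ofReal (union_bound_le hr hk hl hd' hm))
  set good := {A : Fin m → Fin n → ℂ | ∃ L U : ℝ, 0 < L ∧ 0 < U ∧
    Real.sqrt (4 / (4 - π)) ≤ U / L ∧ U / L ≤ Real.sqrt (4 / (4 - π)) + 0.01 ∧
    PhaselessBiLip A {z | (l0Norm z : ℝ) ≤ (r + 4) * k} L U}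
  have hμ : 0.21 ≤ 1 - π / 4 := by linarith [Real.pi_lt_d2]
  have hμ' : 0.4 ≤ √(1 - π / 4) := Real.le_sqrt_of_sq_le (by linarith)
  have hs : 0 < √(m : ℝ) := Real.sqrt_pos.2 hm0
  have hκ : Real.sqrt (4 / (4 - π)) = (√(1 - π / 4))⁻¹ := by
    rw [← Real.sqrt_inv]
    congr 1
    rw [show 1 - π / 4 = (4 - π) / 4 by ring, inv_div]
  have hκ' : (√(1 - π / 4))⁻¹ ≤ 2.5 := by
    rw [inv_le_comm₀ (by linarith) (by norm_num)]
    linarith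
  have hκ0 : 0 < (√(1 - π / 4))⁻¹ := inv_pos.2 (by linarith)
  have hratio : 1.001 * √m / (0.999 * √(1 - π / 4) * √m) =
      1.001 / 0.999 * (√(1 - π / 4))⁻¹ := by
    field_simp
  have hcover : (Set.univ : Set (Fin m → Fin n → ℂ)) ⊆
      good ∪ {A | ∃ T : Finset (Fin n), T.card ≤ d ∧ ¬ GoodOn A T} := by
    intro A _
    by_cases hA : ∃ T : Finset (Fin n), T.card ≤ d ∧ ¬ GoodOn A T
    · exact Or.inr hA
    · push Not at hA
      refine Or.inl ⟨0.999 * √(1 - π / 4) * √m, 1.001 * √m, by positivity, by positivity,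
        ?_, ?_, phaselessBiLip_of_goodOn (by exact_mod_cast hm0) hA⟩
      · rw [hratio, hκ]
        exact le_mul_of_one_le_left hκ0.le (by norm_num)
      · rw [hratio, hκ]
        norm_num at hκ' ⊢
        linarith
  have hprob : gaussMatrixComplex m n Set.univ = 1 := by
    rw [gaussMatrixComplex_eq_pi]
    exact measure_univ
  have h1 : 1 ≤ gaussMatrixComplex m n good + ENNReal.ofReal (Real.exp (-(0.0000000005 / 2) * m)) := by
    rw [← hprob]
    exact (measure_mono hcover).trans ((measure_union_le _ _).trans (by gcongr))
  rw [ENNReal.ofReal_sub _ (Real.exp_pos _).le, ENNReal.ofReal_one]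
  exact tsub_le_iff_right.2 h1
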